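/- arXiv:2212.06618 — 2 statements merged into one kernel-verified Lean document; each statement's English description precedes it below -/
import Mathlib

section
/- Let p be a prime number, let η ∈ ℂ be a primitive p-th root of unity, let s₁, s₂ be integers with 1 ≤ s₁ ≤ p − 1 and 1 ≤ s₂ ≤ p − 1, and let a, b, c, d ∈ ℂ with ad − bc ≠ 0. Suppose that b = 0 and that for every integer k with 0 ≤ k ≤ p − 1 one has a·η^{k s₁} + b = η^{k s₂}·(c·η^{k s₁} + d). Then s₁ = s₂. -/
/-- Let `p` be prime, `η ∈ ℂ` a primitive `p`-th root of unity,
`1 ≤ s₁, s₂ ≤ p - 1`, and `a, b, c, d ∈ ℂ` with `a*d - b*c ≠ 0` and `b = 0`. If for every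
`0 ≤ k ≤ p - 1` we have `a·η^(k·s₁) + b = η^(k·s₂)·(c·η^(k·s₁) + d)`, then `s₁ = s₂`. -/
theorem mobius_fixed_points_distinct (p : ℕ) (hp : p.Prime) (η : ℂ)
    (hη : IsPrimitiveRoot η p)
    (s₁ s₂ : ℕ) (hs₁ : 1 ≤ s₁) (hs₁' : s₁ ≤ p - 1) (hs₂ : 1 ≤ s₂) (hs₂' : s₂ ≤ p - 1)
    (a b c d : ℂ) (hdet : a * d - b * c ≠ 0) (hb : b = 0)
    (h : ∀ k : ℕ, k ≤ p - 1 →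
      a * η ^ (k * s₁) + b = η ^ (k * s₂) * (c * η ^ (k * s₁) + d)) :
    s₁ = s₂ := by
  subst hb
  have hp2 := hp.two_le
  by_cases h2 : p = 2
  · omega
  have e0 := h 0 (by omega)
  have e1 := h 1 (by omega)
  have e2 := h 2 (by omega)
  have hx0 : η ^ s₁ ≠ 0 := pow_ne_zero _ (hη.ne_zero (by omega))
  have hy1 : η ^ s₂ ≠ 1 := hη.pow_ne_one_of_pos_of_lt (by omega) (by omega)
  have ha : a ≠ 0 := by
    rintro rfl
    simp at hdet
  have inj : η ^ s₁ = η ^ s₂ → s₁ = s₂ := fun e => hη.pow_inj (by omega) (by omega) e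
  apply inj
  simp only [mul_comm _ s₁, mul_comm _ s₂, pow_mul] at e0 e1 e2
  generalize η ^ s₁ = x at *
  generalize η ^ s₂ = y at *
  have key : a * x * (1 - y) * (x - y) = 0 := by
    linear_combination e2 - (x * y + y) * e1 + x * y * y * e0
  have h1 : (1 - y) ≠ 0 := sub_ne_zero.mpr (Ne.symm hy1)
  have := (mul_eq_zero.mp key).resolve_left (mul_ne_zero (mul_ne_zero ha hx0) h1)
  exact sub_eq_zero.mp this
end

section
/- Let p be a prime number and let η ∈ ℂ be a primitive p-th root of unity. For c ∈ ℂ let M(c) be the 2×2 complex matrix with rows (η, 0) and (c, 1 − c). Then the set of all c ∈ ℂ such that the vector M(c)^{p−1}·(η, 1)ᵀ has equal first and second coordinates is finite and has at most p − 1 elements. -/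
open Matrix Polynomial in
lemma mobius_aux (η : ℂ) (n : ℕ) : ∃ Q : ℂ[X], Q.natDegree ≤ n ∧ Q.eval 1 = η ^ n ∧
    ∀ c : ℂ, ((!![η, 0; c, 1 - c] : Matrix (Fin 2) (Fin 2) ℂ) ^ n *ᵥ ![η, 1])
      = ![η ^ (n + 1), Q.eval c] := by
  induction n with
  | zero => exact ⟨1, by simp, by simp, by intro c; simp⟩
  | succ n ih =>
    obtain ⟨Q, hd, h1, hQ⟩ := ih
    refine ⟨X * C (η ^ (n + 1)) + (1 - X) * Q, ?_, by simp, ?_⟩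
    · have hx : (1 - X : ℂ[X]).natDegree ≤ 1 := by
        refine (natDegree_sub_le _ _).trans ?_
        simp
      refine (natDegree_add_le _ _).trans (max_le ?_ ?_)
      · refine natDegree_mul_le.trans ?_
        simp
      · refine natDegree_mul_le.trans ?_
        omega
    · intro c
      rw [pow_succ', ← Matrix.mulVec_mulVec, hQ c]
      ext i
      fin_cases i
      · simp [Matrix.mulVec, dotProduct, Fin.sum_univ_two]
        ring
      · simp [Matrix.mulVec, dotProduct, Fin.sum_univ_two]

open Matrix in
/-- Let `p` be prime and `η ∈ ℂ` a primitive `p`-th root of unity. For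
`c ∈ ℂ` let `M c` be the matrix with rows `(η, 0)` and `(c, 1 - c)`. Then the set of `c`
such that `(M c)^(p-1) · (η, 1)ᵀ` has equal coordinates is finite, with at most `p - 1`
elements. -/
theorem mobius_fixed_point_equation_finite (p : ℕ) (hp : p.Prime) (η : ℂ)
    (hη : IsPrimitiveRoot η p) :
    {c : ℂ | ((!![η, 0; c, 1 - c] : Matrix (Fin 2) (Fin 2) ℂ) ^ (p - 1) *ᵥ ![η, 1]) 0
        = ((!![η, 0; c, 1 - c] : Matrix (Fin 2) (Fin 2) ℂ) ^ (p - 1) *ᵥ ![η, 1]) 1}.Finite ∧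
    {c : ℂ | ((!![η, 0; c, 1 - c] : Matrix (Fin 2) (Fin 2) ℂ) ^ (p - 1) *ᵥ ![η, 1]) 0
        = ((!![η, 0; c, 1 - c] : Matrix (Fin 2) (Fin 2) ℂ) ^ (p - 1) *ᵥ ![η, 1]) 1}.ncard
      ≤ p - 1 := by
  obtain ⟨Q, hd, h1, hQ⟩ := mobius_aux η (p - 1)
  have hp2 := hp.two_le
  have hp1 : p - 1 + 1 = p := by omega
  have hne : Q - 1 ≠ 0 := by
    intro h
    have h2 := congrArg (Polynomial.eval 1) h
    simp only [Polynomial.eval_sub, h1, Polynomial.eval_one, Polynomial.eval_zero] at h2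
    have h3 := hη.pow_ne_one_of_pos_of_lt (l := p - 1) (by omega) (by omega)
    exact h3 (sub_eq_zero.mp h2)
  have hdeg : (Q - 1).natDegree ≤ p - 1 := by
    refine (Polynomial.natDegree_sub_le _ _).trans ?_
    simpa using hd
  have hset : {c : ℂ | ((!![η, 0; c, 1 - c] : Matrix (Fin 2) (Fin 2) ℂ) ^ (p - 1) *ᵥ ![η, 1]) 0
        = ((!![η, 0; c, 1 - c] : Matrix (Fin 2) (Fin 2) ℂ) ^ (p - 1) *ᵥ ![η, 1]) 1}
      = ((Q - 1).roots.toFinset : Set ℂ) := by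
    ext c
    rw [Set.mem_ofPred_eq, hQ c, hp1, hη.pow_eq_one]
    simp only [Finset.mem_coe, Multiset.mem_toFinset, Polynomial.mem_roots hne, Polynomial.IsRoot.def, Polynomial.eval_sub, Polynomial.eval_one, sub_eq_zero]
    exact eq_comm
  rw [hset]
  refine ⟨Finset.finite_toSet _, ?_⟩
  rw [Set.ncard_coe_finset]
  exact (Multiset.toFinset_card_le _).trans ((Polynomial.card_roots' _).trans hdeg)
end
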